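/- There exists a simple polygon P in the plane and a point s in the interior of P such that the region V_2(s) visible from s after at most two diffuse reflections is multiply connected; precisely, the complement ℝ² \ V_2(s) has a bounded connected component that is entirely contained in the interior of P (a hole, or blind spot, of V_2(s)). -/

import Mathlib

noncomputable section
open Set

/-- Points of the Euclidean plane. -/
abbrev Pt := EuclideanSpace ℝ (Fin 2)

/-- A simple polygon in the plane: a compact set with nonempty connected
interior whose topological frontier is the union of finitely many closed
nondegenerate line segments (the edges), any two of which meet in at most a
common endpoint, each vertex lying on exactly two edges, the frontier forming
a single closed (connected) polygonal Jordan curve. -/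
structure SimplePolygon where
  carrier : Set Pt
  edges : Finset (Pt × Pt)
  isCompact : IsCompact carrier
  interior_nonempty : (interior carrier).Nonempty
  interior_connected : IsConnected (interior carrier)
  edges_nondeg : ∀ e ∈ edges, e.1 ≠ e.2
  frontier_eq : frontier carrier = ⋃ e ∈ edges, segment ℝ e.1 e.2
  edges_meet : ∀ e ∈ edges, ∀ f ∈ edges, e ≠ f →
    segment ℝ e.1 e.2 ∩ segment ℝ f.1 f.2 ⊆ ({e.1, e.2} ∩ {f.1, f.2} : Set Pt)
  vertex_deg_two : ∀ e ∈ edges, ∀ v ∈ ({e.1, e.2} : Set Pt),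
    {f | f ∈ edges ∧ (v = f.1 ∨ v = f.2)}.ncard = 2
  frontier_connected : IsConnected (frontier carrier)

/-- Two points of `P` are mutually visible if the open segment joining them
lies in the interior of `P`. -/
def MutuallyVisible (P : Set Pt) (x y : Pt) : Prop :=
  x ∈ P ∧ y ∈ P ∧ openSegment ℝ x y ⊆ interior P

/-- `p` lies in the relative interior of some edge of the polygon `Q`. -/
def OnEdgeInterior (Q : SimplePolygon) (p : Pt) : Prop :=
  ∃ e ∈ Q.edges, p ∈ openSegment ℝ e.1 e.2

/-- `Vk Q s k` : the set of points of the polygon `Q` visible from `s` after at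
most `k` diffuse reflections, i.e. points `y ∈ Q` for which there are `l ≤ k`
points `c 1, …, c l` in relative interiors of edges with consecutive members of
the chain `s = c 0, c 1, …, c l, c (l+1) = y` mutually visible. -/
def Vk (Q : SimplePolygon) (s : Pt) (k : ℕ) : Set Pt :=
  {y | y ∈ Q.carrier ∧ ∃ l : ℕ, l ≤ k ∧ ∃ c : ℕ → Pt,
    c 0 = s ∧ c (l + 1) = y ∧
    (∀ i : ℕ, 1 ≤ i → i ≤ l → OnEdgeInterior Q (c i)) ∧
    (∀ i : ℕ, i ≤ l → MutuallyVisible Q.carrier (c i) (c (i + 1)))}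

/-! ### Regions between two graphs -/

/-- The part of the strip `l ≤ x ≤ r` between the graphs of `f` and `g`. -/
def regionBetweenGraphs (f g : ℝ → ℝ) (l r : ℝ) : Set Pt :=
  {p | l ≤ p 0 ∧ p 0 ≤ r ∧ f (p 0) ≤ p 1 ∧ p 1 ≤ g (p 0)}

/-- Parametrization of the region between two graphs by a rectangle. -/
def graphInterpolation (f g : ℝ → ℝ) (z : ℝ × ℝ) : Pt :=
  !₂[z.1, (1 - z.2) * f z.1 + z.2 * g z.1]

lemma pt_ext {p q : Pt} (h0 : p 0 = q 0) (h1 : p 1 = q 1) : p = q := by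
  ext i; fin_cases i <;> assumption

section Region

variable {f g : ℝ → ℝ} {l r : ℝ}

lemma continuous_graphInterpolation (hf : Continuous f) (hg : Continuous g) :
    Continuous (graphInterpolation f g) := by
  unfold graphInterpolation
  refine (PiLp.continuous_toLp 2 _).comp (continuous_pi fun i => ?_)
  fin_cases i
  · exact continuous_fst
  · show Continuous fun z : ℝ × ℝ => (1 - z.2) * f z.1 + z.2 * g z.1
    fun_prop

lemma mem_image_graphInterpolation (hfg : ∀ x, l ≤ x → x ≤ r → f x < g x) {p : Pt}
    (hl : l ≤ p 0) (hr : p 0 ≤ r) (I J : Set ℝ) (hI : p 0 ∈ I)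
    (hJ : (p 1 - f (p 0)) / (g (p 0) - f (p 0)) ∈ J) :
    p ∈ graphInterpolation f g '' (I ×ˢ J) := by
  have h := hfg _ hl hr
  have h' : g (p 0) - f (p 0) ≠ 0 := by linarith
  refine ⟨(p 0, _), ⟨hI, hJ⟩, pt_ext rfl ?_⟩
  simp only [graphInterpolation]
  show (1 - _) * _ + _ * _ = _
  field_simp
  ring

lemma regionBetweenGraphs_eq_image (hfg : ∀ x, l ≤ x → x ≤ r → f x < g x) :
    regionBetweenGraphs f g l r = graphInterpolation f g '' (Icc l r ×ˢ Icc 0 1) := by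
  ext p
  constructor
  · rintro ⟨hl, hr, h1, h2⟩
    have h := hfg _ hl hr
    refine mem_image_graphInterpolation hfg hl hr _ _ ⟨hl, hr⟩ ⟨?_, ?_⟩
    · exact div_nonneg (by linarith) (by linarith)
    · rw [div_le_one (by linarith)]; linarith
  · rintro ⟨⟨a, b⟩, ⟨⟨hl, hr⟩, h0, h1⟩, rfl⟩
    have h := hfg a hl hr
    simp only at h0 h1 hl hr
    refine ⟨hl, hr, ?_, ?_⟩
    · show f a ≤ (1 - b) * f a + b * g a
      nlinarith
    · show (1 - b) * f a + b * g a ≤ g a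
      nlinarith

lemma isCompact_regionBetweenGraphs (hf : Continuous f) (hg : Continuous g)
    (hfg : ∀ x, l ≤ x → x ≤ r → f x < g x) : IsCompact (regionBetweenGraphs f g l r) := by
  rw [regionBetweenGraphs_eq_image hfg]
  exact (isCompact_Icc.prod isCompact_Icc).image (continuous_graphInterpolation hf hg)

lemma exists_pos_add_smul_mem_of_mem_interior {s : Set Pt} {p : Pt} (hp : p ∈ interior s)
    (v : Pt) : ∃ ε : ℝ, 0 < ε ∧ p + ε • v ∈ s ∧ p + (-ε) • v ∈ s := by
  have ht : Filter.Tendsto (fun t : ℝ => p + t • v) (nhds 0) (nhds p) := by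
    have : Continuous fun t : ℝ => p + t • v := by fun_prop
    simpa using this.tendsto 0
  have := ht (mem_interior_iff_mem_nhds.1 hp)
  obtain ⟨ε, hε, h⟩ := Metric.mem_nhds_iff.1 (Filter.mem_map.1 this)
  refine ⟨ε / 2, by linarith, h ?_, h ?_⟩
  · rw [Metric.mem_ball, Real.dist_eq, abs_lt]; constructor <;> linarith
  · rw [Metric.mem_ball, Real.dist_eq, abs_lt]; constructor <;> linarith

lemma interior_regionBetweenGraphs (hf : Continuous f) (hg : Continuous g) :
    interior (regionBetweenGraphs f g l r) =
      {p : Pt | l < p 0 ∧ p 0 < r ∧ f (p 0) < p 1 ∧ p 1 < g (p 0)} := by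
  apply subset_antisymm
  · intro p hp
    obtain ⟨ε, hε, h1, h2⟩ := exists_pos_add_smul_mem_of_mem_interior hp !₂[1, 0]
    obtain ⟨δ, hδ, h3, h4⟩ := exists_pos_add_smul_mem_of_mem_interior hp !₂[0, 1]
    simp [regionBetweenGraphs] at h1 h2 h3 h4
    obtain ⟨a1, a2, a3, a4⟩ := h1
    obtain ⟨b1, b2, b3, b4⟩ := h2
    obtain ⟨c1, c2, c3, c4⟩ := h3
    obtain ⟨d1, d2, d3, d4⟩ := h4
    refine ⟨?_, ?_, ?_, ?_⟩ <;> linarith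
  · refine interior_maximal (fun p hp => ⟨hp.1.le, hp.2.1.le, hp.2.2.1.le, hp.2.2.2.le⟩) ?_
    have h1 : IsOpen {p : Pt | l < p 0} := isOpen_lt (by fun_prop) (by fun_prop)
    have h2 : IsOpen {p : Pt | p 0 < r} := isOpen_lt (by fun_prop) (by fun_prop)
    have h3 : IsOpen {p : Pt | f (p 0) < p 1} := isOpen_lt (by fun_prop) (by fun_prop)
    have h4 : IsOpen {p : Pt | p 1 < g (p 0)} := isOpen_lt (by fun_prop) (by fun_prop)
    exact h1.inter (h2.inter (h3.inter h4))

lemma isConnected_interior_regionBetweenGraphs (hf : Continuous f) (hg : Continuous g)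
    (hlr : l < r) (hfg : ∀ x, l ≤ x → x ≤ r → f x < g x) :
    IsConnected (interior (regionBetweenGraphs f g l r)) := by
  have : interior (regionBetweenGraphs f g l r) =
      graphInterpolation f g '' (Ioo l r ×ˢ Ioo 0 1) := by
    rw [interior_regionBetweenGraphs hf hg]
    ext p
    constructor
    · rintro ⟨hl, hr, h1, h2⟩
      have h := hfg _ hl.le hr.le
      refine mem_image_graphInterpolation hfg hl.le hr.le _ _ ⟨hl, hr⟩ ⟨?_, ?_⟩
      · exact div_pos (by linarith) (by linarith)
      · rw [div_lt_one (by linarith)]; linarith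
    · rintro ⟨⟨a, b⟩, ⟨⟨hl, hr⟩, h0, h1⟩, rfl⟩
      simp only at h0 h1 hl hr
      have h := hfg a hl.le hr.le
      refine ⟨hl, hr, ?_, ?_⟩
      · show f a < (1 - b) * f a + b * g a
        nlinarith
      · show (1 - b) * f a + b * g a < g a
        nlinarith
  rw [this]
  exact ((isConnected_Ioo hlr).prod (isConnected_Ioo one_pos)).image _
    (continuous_graphInterpolation hf hg).continuousOn

lemma mem_frontier_regionBetweenGraphs (hf : Continuous f) (hg : Continuous g)
    (hfg : ∀ x, l ≤ x → x ≤ r → f x < g x) {p : Pt} :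
    p ∈ frontier (regionBetweenGraphs f g l r) ↔
      p ∈ regionBetweenGraphs f g l r ∧ (p 0 = l ∨ p 0 = r ∨ p 1 = f (p 0) ∨ p 1 = g (p 0)) := by
  rw [(isCompact_regionBetweenGraphs hf hg hfg).isClosed.frontier_eq,
    interior_regionBetweenGraphs hf hg, mem_sdiff]
  refine and_congr_right fun ⟨h1, h2, h3, h4⟩ => ?_
  rw [mem_ofPred_eq, not_and_or, not_and_or, not_and_or, not_lt, not_lt, not_lt, not_lt]
  exact or_congr ⟨fun h => le_antisymm h h1, fun h => h.le⟩
    (or_congr ⟨fun h => le_antisymm h2 h, fun h => h.ge⟩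
    (or_congr ⟨fun h => le_antisymm h h3, fun h => h.le⟩
    ⟨fun h => le_antisymm h4 h, fun h => h.ge⟩))

lemma isConnected_frontier_regionBetweenGraphs (hf : Continuous f) (hg : Continuous g)
    (hlr : l < r) (hfg : ∀ x, l ≤ x → x ≤ r → f x < g x) :
    IsConnected (frontier (regionBetweenGraphs f g l r)) := by
  have key : frontier (regionBetweenGraphs f g l r) = graphInterpolation f g ''
      (({l} ×ˢ Icc 0 1 ∪ Icc l r ×ˢ {0}) ∪ ({r} ×ˢ Icc 0 1 ∪ Icc l r ×ˢ {1})) := by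
    ext p
    rw [mem_frontier_regionBetweenGraphs hf hg hfg]
    constructor
    · rintro ⟨⟨hl, hr, h1, h2⟩, h⟩
      have hlt := hfg _ hl hr
      have hJ : (p 1 - f (p 0)) / (g (p 0) - f (p 0)) ∈ Icc (0 : ℝ) 1 :=
        ⟨div_nonneg (by linarith) (by linarith),
          by rw [div_le_one (by linarith)]; linarith⟩
      rw [image_union, image_union, image_union]
      rcases h with h | h | h | h
      · exact Or.inl (Or.inl (mem_image_graphInterpolation hfg hl hr _ _ h hJ))
      · exact Or.inr (Or.inl (mem_image_graphInterpolation hfg hl hr _ _ h hJ))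
      · refine Or.inl (Or.inr (mem_image_graphInterpolation hfg hl hr _ _ ⟨hl, hr⟩ ?_))
        rw [h]; simp
      · refine Or.inr (Or.inr (mem_image_graphInterpolation hfg hl hr _ _ ⟨hl, hr⟩ ?_))
        rw [h]; exact div_self (by linarith)
    · rintro ⟨⟨a, b⟩, h, rfl⟩
      have hab : (a, b) ∈ Icc l r ×ˢ Icc (0 : ℝ) 1 := by
        simp only [mem_union, mem_prod, mem_singleton_iff, mem_Icc] at h ⊢
        rcases h with (⟨h, h'⟩ | ⟨h, h'⟩) | (⟨h, h'⟩ | ⟨h, h'⟩) <;>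
          refine ⟨⟨?_, ?_⟩, ?_, ?_⟩ <;> linarith
      refine ⟨by rw [regionBetweenGraphs_eq_image hfg]; exact ⟨_, hab, rfl⟩, ?_⟩
      show a = l ∨ a = r ∨ (1 - b) * f a + b * g a = f a ∨ (1 - b) * f a + b * g a = g a
      simp only [mem_union, mem_prod, mem_singleton_iff] at h
      rcases h with (⟨h, -⟩ | ⟨-, h⟩) | (⟨h, -⟩ | ⟨-, h⟩)
      · exact Or.inl h
      · exact Or.inr (Or.inr (Or.inl (by rw [h]; ring)))
      · exact Or.inr (Or.inl h)
      · exact Or.inr (Or.inr (Or.inr (by rw [h]; ring)))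
  rw [key]
  refine IsConnected.image ?_ _ (continuous_graphInterpolation hf hg).continuousOn
  have hI : IsConnected (Icc (0 : ℝ) 1) := isConnected_Icc zero_le_one
  have hlr' : IsConnected (Icc l r) := isConnected_Icc hlr.le
  refine IsConnected.union ⟨(r, 0), ?_, ?_⟩
    (IsConnected.union ⟨(l, 0), ?_, ?_⟩ (isConnected_singleton.prod hI)
      (hlr'.prod isConnected_singleton))
    (IsConnected.union ⟨(r, 1), ?_, ?_⟩ (isConnected_singleton.prod hI)
      (hlr'.prod isConnected_singleton)) <;> simp [hlr.le]

lemma MutuallyVisible.symm {P : Set Pt} {p q : Pt} (h : MutuallyVisible P p q) :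
    MutuallyVisible P q p :=
  ⟨h.2.1, h.1, by rw [openSegment_symm]; exact h.2.2⟩

/-- A sight line between points with different abscissae is the graph of an affine function
lying strictly between the bounding graphs. -/
lemma MutuallyVisible.exists_line (hf : Continuous f) (hg : Continuous g) {q p : Pt}
    (h : MutuallyVisible (regionBetweenGraphs f g l r) q p) (hqp : q 0 < p 0) :
    ∃ m k : ℝ, q 1 = m * q 0 + k ∧ p 1 = m * p 0 + k ∧
      ∀ c, q 0 < c → c < p 0 → f c < m * c + k ∧ m * c + k < g c := by
  have hne : p 0 - q 0 ≠ 0 := by linarith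
  refine ⟨(p 1 - q 1) / (p 0 - q 0), q 1 - (p 1 - q 1) / (p 0 - q 0) * q 0, by ring, ?_, ?_⟩
  · field_simp; ring
  · intro c h1 h2
    have hz : (!₂[c, (p 1 - q 1) / (p 0 - q 0) * c +
        (q 1 - (p 1 - q 1) / (p 0 - q 0) * q 0)] : Pt) ∈ openSegment ℝ q p := by
      refine ⟨(p 0 - c) / (p 0 - q 0), (c - q 0) / (p 0 - q 0), div_pos (by linarith)
        (by linarith), div_pos (by linarith) (by linarith), by field_simp; ring, pt_ext ?_ ?_⟩
      · simp; field_simp; ring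
      · simp; field_simp; ring
    have := h.2.2 hz
    rw [interior_regionBetweenGraphs hf hg] at this
    exact ⟨this.2.2.1, this.2.2.2⟩

lemma mutuallyVisible_of_line (hf : Continuous f) (hg : Continuous g) {q p : Pt} (m k : ℝ)
    (hqp : q 0 < p 0) (hl : l ≤ q 0) (hr : p 0 ≤ r) (hq : q 1 = m * q 0 + k)
    (hp : p 1 = m * p 0 + k) (h : ∀ c, q 0 ≤ c → c ≤ p 0 → f c ≤ m * c + k ∧ m * c + k ≤ g c)
    (h' : ∀ c, q 0 < c → c < p 0 → f c < m * c + k ∧ m * c + k < g c) :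
    MutuallyVisible (regionBetweenGraphs f g l r) q p := by
  refine ⟨⟨hl, by linarith, ?_⟩, ⟨by linarith, hr, ?_⟩, ?_⟩
  · rw [hq]; exact h _ le_rfl hqp.le
  · rw [hp]; exact h _ hqp.le le_rfl
  · rintro z ⟨a, b, ha, hb, hab, rfl⟩
    rw [interior_regionBetweenGraphs hf hg]
    have e0 : (a • q + b • p) 0 = a * q 0 + b * p 0 := by simp
    have e1 : (a • q + b • p) 1 = m * (a * q 0 + b * p 0) + k := by
      have : (a • q + b • p) 1 = a * q 1 + b * p 1 := by simp
      rw [this, hq, hp]; linear_combination k * hab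
    have h1 : q 0 < a * q 0 + b * p 0 := by
      obtain rfl : a = 1 - b := by linarith
      nlinarith
    have h2 : a * q 0 + b * p 0 < p 0 := by
      obtain rfl : a = 1 - b := by linarith
      nlinarith
    rw [mem_ofPred_eq, e0, e1]
    exact ⟨by linarith, by linarith, h' _ h1 h2⟩

end Region

/-! ### Segments with integer endpoints -/

/-- The point of the plane with given integer coordinates. -/
def toPt (z : ℤ × ℤ) : Pt := !₂[(z.1 : ℝ), (z.2 : ℝ)]

/-- Twice the signed area of the triangle `a b c`. -/
def orient (a b c : ℤ × ℤ) : ℤ :=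
  (b.1 - a.1) * (c.2 - a.2) - (b.2 - a.2) * (c.1 - a.1)

@[simp] lemma toPt_zero (z : ℤ × ℤ) : toPt z 0 = z.1 := rfl

@[simp] lemma toPt_one (z : ℤ × ℤ) : toPt z 1 = z.2 := rfl

lemma toPt_injective : Function.Injective toPt := by
  intro a b h
  have h0 := congrArg (fun p : Pt => p 0) h
  have h1 := congrArg (fun p : Pt => p 1) h
  simp only [toPt_zero, toPt_one, Int.cast_inj] at h0 h1
  exact Prod.ext h0 h1

lemma add_mul_orient_eq_zero {a b c d : ℤ × ℤ} {α β : ℝ} (h : α + β = 1)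
    (hp : α • toPt c + β • toPt d ∈ segment ℝ (toPt a) (toPt b)) :
    α * orient a b c + β * orient a b d = 0 := by
  obtain ⟨s, t, -, -, hst, e⟩ := hp
  have e0 := congrArg (fun p : Pt => p 0) e
  have e1 := congrArg (fun p : Pt => p 1) e
  simp only [PiLp.add_apply, PiLp.smul_apply, toPt_zero, toPt_one, smul_eq_mul] at e0 e1
  obtain rfl : s = 1 - t := by linarith
  obtain rfl : α = 1 - β := by linarith
  simp only [orient]
  push_cast
  linear_combination (-(b.1 - a.1 : ℝ)) * e1 + (b.2 - a.2 : ℝ) * e0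

/-- The segment `c d` lies strictly on one side of the line `a b`. -/
def OnOneSide (a b c d : ℤ × ℤ) : Prop :=
  0 < orient a b c ∧ 0 < orient a b d ∨ orient a b c < 0 ∧ orient a b d < 0

instance (a b c d : ℤ × ℤ) : Decidable (OnOneSide a b c d) := by
  unfold OnOneSide; infer_instance

lemma OnOneSide.segment_inter_eq_empty {a b c d : ℤ × ℤ} (h : OnOneSide a b c d) :
    segment ℝ (toPt a) (toPt b) ∩ segment ℝ (toPt c) (toPt d) = ∅ := by
  rw [eq_empty_iff_forall_notMem]
  rintro p ⟨hp, α, β, hα, hβ, hab, rfl⟩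
  have e := add_mul_orient_eq_zero hab hp
  obtain rfl : α = 1 - β := by linarith
  rcases h with ⟨h1, h2⟩ | ⟨h1, h2⟩
  · have h1' : (0 : ℝ) < orient a b c := by exact_mod_cast h1
    have h2' : (0 : ℝ) < orient a b d := by exact_mod_cast h2
    rcases hβ.eq_or_lt with rfl | hβ <;> nlinarith
  · have h1' : (orient a b c : ℝ) < 0 := by exact_mod_cast h1
    have h2' : (orient a b d : ℝ) < 0 := by exact_mod_cast h2
    rcases hβ.eq_or_lt with rfl | hβ <;> nlinarith

lemma segment_inter_subset_of_orient_ne_zero {a b d : ℤ × ℤ} (h : orient a b d ≠ 0) :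
    segment ℝ (toPt a) (toPt b) ∩ segment ℝ (toPt b) (toPt d) ⊆ {toPt b} := by
  rintro p ⟨hp, α, β, hα, hβ, hab, rfl⟩
  have e := add_mul_orient_eq_zero hab hp
  have h0 : orient a b b = 0 := by simp only [orient]; ring
  have h' : (orient a b d : ℝ) ≠ 0 := by exact_mod_cast h
  have hβ0 : β = 0 := by simpa [h0, h'] using e
  obtain rfl : α = 1 := by linarith
  simp [hβ0]

lemma mem_segment_toPt_iff {a b : ℤ × ℤ} (h : a.1 < b.1) {p : Pt} :
    p ∈ segment ℝ (toPt a) (toPt b) ↔ (a.1 : ℝ) ≤ p 0 ∧ p 0 ≤ b.1 ∧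
      (p 1 - a.2) * (b.1 - a.1) = (b.2 - a.2) * (p 0 - a.1) := by
  have h' : (a.1 : ℝ) < b.1 := by exact_mod_cast h
  have hne : (b.1 : ℝ) - a.1 ≠ 0 := by linarith
  constructor
  · rintro ⟨s, t, hs, ht, hst, rfl⟩
    obtain rfl : s = 1 - t := by linarith
    simp only [PiLp.add_apply, PiLp.smul_apply, toPt_zero, toPt_one, smul_eq_mul]
    refine ⟨by nlinarith, by nlinarith, by ring⟩
  · rintro ⟨h1, h2, h3⟩
    refine ⟨(b.1 - p 0) / (b.1 - a.1), (p 0 - a.1) / (b.1 - a.1), div_nonneg (by linarith)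
      (by linarith), div_nonneg (by linarith) (by linarith), by field_simp; ring,
      pt_ext ?_ ?_⟩
    · simp only [PiLp.add_apply, PiLp.smul_apply, toPt_zero, smul_eq_mul]
      field_simp; ring
    · simp only [PiLp.add_apply, PiLp.smul_apply, toPt_one, smul_eq_mul]
      field_simp; linear_combination -h3

lemma mem_openSegment_toPt_iff {a b : ℤ × ℤ} (h : a.1 < b.1) {p : Pt} :
    p ∈ openSegment ℝ (toPt a) (toPt b) ↔ (a.1 : ℝ) < p 0 ∧ p 0 < b.1 ∧
      (p 1 - a.2) * (b.1 - a.1) = (b.2 - a.2) * (p 0 - a.1) := by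
  have h' : (a.1 : ℝ) < b.1 := by exact_mod_cast h
  have hne : (b.1 : ℝ) - a.1 ≠ 0 := by linarith
  constructor
  · rintro ⟨s, t, hs, ht, hst, rfl⟩
    obtain rfl : s = 1 - t := by linarith
    simp only [PiLp.add_apply, PiLp.smul_apply, toPt_zero, toPt_one, smul_eq_mul]
    refine ⟨by nlinarith, by nlinarith, by ring⟩
  · rintro ⟨h1, h2, h3⟩
    refine ⟨(b.1 - p 0) / (b.1 - a.1), (p 0 - a.1) / (b.1 - a.1), div_pos (by linarith)
      (by linarith), div_pos (by linarith) (by linarith), by field_simp; ring,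
      pt_ext ?_ ?_⟩
    · simp only [PiLp.add_apply, PiLp.smul_apply, toPt_zero, smul_eq_mul]
      field_simp; ring
    · simp only [PiLp.add_apply, PiLp.smul_apply, toPt_one, smul_eq_mul]
      field_simp; linear_combination -h3

lemma mem_segment_toPt_vertical_iff {x c d : ℤ} (h : c < d) {p : Pt} :
    p ∈ segment ℝ (toPt (x, c)) (toPt (x, d)) ↔ p 0 = x ∧ (c : ℝ) ≤ p 1 ∧ p 1 ≤ d := by
  have h' : (c : ℝ) < d := by exact_mod_cast h
  have hne : (d : ℝ) - c ≠ 0 := by linarith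
  constructor
  · rintro ⟨s, t, hs, ht, hst, rfl⟩
    obtain rfl : s = 1 - t := by linarith
    simp only [PiLp.add_apply, PiLp.smul_apply, toPt_zero, toPt_one, smul_eq_mul]
    refine ⟨by ring, by nlinarith, by nlinarith⟩
  · rintro ⟨h1, h2, h3⟩
    refine ⟨(d - p 1) / (d - c), (p 1 - c) / (d - c), div_nonneg (by linarith)
      (by linarith), div_nonneg (by linarith) (by linarith), by field_simp; ring,
      pt_ext ?_ ?_⟩
    · simp only [PiLp.add_apply, PiLp.smul_apply, toPt_zero, smul_eq_mul, h1]
      field_simp; ring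
    · simp only [PiLp.add_apply, PiLp.smul_apply, toPt_one, smul_eq_mul]
      field_simp; ring

lemma mem_openSegment_toPt_vertical_iff {x c d : ℤ} (h : c < d) {p : Pt} :
    p ∈ openSegment ℝ (toPt (x, c)) (toPt (x, d)) ↔ p 0 = x ∧ (c : ℝ) < p 1 ∧ p 1 < d := by
  have h' : (c : ℝ) < d := by exact_mod_cast h
  have hne : (d : ℝ) - c ≠ 0 := by linarith
  constructor
  · rintro ⟨s, t, hs, ht, hst, rfl⟩
    obtain rfl : s = 1 - t := by linarith
    simp only [PiLp.add_apply, PiLp.smul_apply, toPt_zero, toPt_one, smul_eq_mul]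
    refine ⟨by ring, by nlinarith, by nlinarith⟩
  · rintro ⟨h1, h2, h3⟩
    refine ⟨(d - p 1) / (d - c), (p 1 - c) / (d - c), div_pos (by linarith)
      (by linarith), div_pos (by linarith) (by linarith), by field_simp; ring,
      pt_ext ?_ ?_⟩
    · simp only [PiLp.add_apply, PiLp.smul_apply, toPt_zero, smul_eq_mul, h1]
      field_simp; ring
    · simp only [PiLp.add_apply, PiLp.smul_apply, toPt_one, smul_eq_mul]
      field_simp; ring

/-! ### The polygon -/

/-- The lower boundary of the polygon. -/
def floorFn (x : ℝ) : ℝ :=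
  -1 - 1 / 2 * max (x + 27) 0 - 617 / 2 * max (x + 7) 0 + 379 * max (x + 6) 0
    - 65 * max (x + 2) 0 - 65 * max (x - 2) 0

/-- The upper boundary of the polygon. -/
def ceilFn (x : ℝ) : ℝ :=
  1 + 49 / 20 * max (x + 32) 0 - 249 / 20 * max (x + 12) 0 + 15 * max (x + 8) 0
    + 75 * max (x + 2) 0 - 170 * max x 0 + 91 * max (x - 2) 0

lemma continuous_floorFn : Continuous floorFn := by unfold floorFn; fun_prop

lemma continuous_ceilFn : Continuous ceilFn := by unfold ceilFn; fun_prop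

lemma max_zero_of_nonneg {c : ℝ} (h : 0 ≤ c) : max c 0 = c := max_eq_left h

lemma max_zero_of_nonpos {c : ℝ} (h : c ≤ 0) : max c 0 = 0 := max_eq_right h

lemma floorFn_cases (x : ℝ) :
    x ≤ -27 ∧ floorFn x = -1 ∨
    -27 ≤ x ∧ x ≤ -7 ∧ floorFn x = -1 - (x + 27) / 2 ∨
    -7 ≤ x ∧ x ≤ -6 ∧ floorFn x = -11 - 309 * (x + 7) ∨
    -6 ≤ x ∧ x ≤ -2 ∧ floorFn x = -40 + 70 * (x + 2) ∨
    -2 ≤ x ∧ x ≤ 2 ∧ floorFn x = -20 + 5 * (x - 2) ∨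
    2 ≤ x ∧ floorFn x = -20 - 60 * (x - 2) := by
  rcases le_total x (-27) with h0 | h0'
  · refine Or.inl ⟨h0, ?_⟩
    rw [floorFn, max_zero_of_nonpos (by linarith : x + 27 ≤ 0),
      max_zero_of_nonpos (by linarith : x + 7 ≤ 0), max_zero_of_nonpos (by linarith : x + 6 ≤ 0),
      max_zero_of_nonpos (by linarith : x + 2 ≤ 0),
      max_zero_of_nonpos (by linarith : x - 2 ≤ 0)]; ring
  rcases le_total x (-7) with h1 | h1'
  · refine Or.inr (Or.inl ⟨h0', h1, ?_⟩)
    rw [floorFn, max_zero_of_nonneg (by linarith : 0 ≤ x + 27),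
      max_zero_of_nonpos (by linarith : x + 7 ≤ 0), max_zero_of_nonpos (by linarith : x + 6 ≤ 0),
      max_zero_of_nonpos (by linarith : x + 2 ≤ 0),
      max_zero_of_nonpos (by linarith : x - 2 ≤ 0)]; ring
  rcases le_total x (-6) with h2 | h2'
  · refine Or.inr (Or.inr (Or.inl ⟨h1', h2, ?_⟩))
    rw [floorFn, max_zero_of_nonneg (by linarith : 0 ≤ x + 27),
      max_zero_of_nonneg (by linarith : 0 ≤ x + 7), max_zero_of_nonpos (by linarith : x + 6 ≤ 0),
      max_zero_of_nonpos (by linarith : x + 2 ≤ 0),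
      max_zero_of_nonpos (by linarith : x - 2 ≤ 0)]; ring
  rcases le_total x (-2) with h3 | h3'
  · refine Or.inr (Or.inr (Or.inr (Or.inl ⟨h2', h3, ?_⟩)))
    rw [floorFn, max_zero_of_nonneg (by linarith : 0 ≤ x + 27),
      max_zero_of_nonneg (by linarith : 0 ≤ x + 7), max_zero_of_nonneg (by linarith : 0 ≤ x + 6),
      max_zero_of_nonpos (by linarith : x + 2 ≤ 0),
      max_zero_of_nonpos (by linarith : x - 2 ≤ 0)]; ring
  rcases le_total x (2) with h4 | h4'
  · refine Or.inr (Or.inr (Or.inr (Or.inr (Or.inl ⟨h3', h4, ?_⟩))))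
    rw [floorFn, max_zero_of_nonneg (by linarith : 0 ≤ x + 27),
      max_zero_of_nonneg (by linarith : 0 ≤ x + 7), max_zero_of_nonneg (by linarith : 0 ≤ x + 6),
      max_zero_of_nonneg (by linarith : 0 ≤ x + 2),
      max_zero_of_nonpos (by linarith : x - 2 ≤ 0)]; ring
  refine Or.inr (Or.inr (Or.inr (Or.inr (Or.inr ⟨h4', ?_⟩))))
  rw [floorFn, max_zero_of_nonneg (by linarith : 0 ≤ x + 27),
    max_zero_of_nonneg (by linarith : 0 ≤ x + 7), max_zero_of_nonneg (by linarith : 0 ≤ x + 6),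
    max_zero_of_nonneg (by linarith : 0 ≤ x + 2),
    max_zero_of_nonneg (by linarith : 0 ≤ x - 2)]; ring

lemma ceilFn_cases (x : ℝ) :
    x ≤ -32 ∧ ceilFn x = 1 ∨
    -32 ≤ x ∧ x ≤ -12 ∧ ceilFn x = 1 + 49 / 20 * (x + 32) ∨
    -12 ≤ x ∧ x ≤ -8 ∧ ceilFn x = 10 - 10 * (x + 8) ∨
    -8 ≤ x ∧ x ≤ -2 ∧ ceilFn x = 10 + 5 * (x + 8) ∨
    -2 ≤ x ∧ x ≤ 0 ∧ ceilFn x = 200 + 80 * x ∨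
    0 ≤ x ∧ x ≤ 2 ∧ ceilFn x = 200 - 90 * x ∨
    2 ≤ x ∧ ceilFn x = 20 + (x - 2) := by
  rcases le_total x (-32) with h0 | h0'
  · refine Or.inl ⟨h0, ?_⟩
    rw [ceilFn, max_zero_of_nonpos (by linarith : x + 32 ≤ 0),
      max_zero_of_nonpos (by linarith : x + 12 ≤ 0), max_zero_of_nonpos (by linarith : x + 8 ≤ 0),
      max_zero_of_nonpos (by linarith : x + 2 ≤ 0), max_zero_of_nonpos (by linarith : x ≤ 0),
      max_zero_of_nonpos (by linarith : x - 2 ≤ 0)]; ring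
  rcases le_total x (-12) with h1 | h1'
  · refine Or.inr (Or.inl ⟨h0', h1, ?_⟩)
    rw [ceilFn, max_zero_of_nonneg (by linarith : 0 ≤ x + 32),
      max_zero_of_nonpos (by linarith : x + 12 ≤ 0), max_zero_of_nonpos (by linarith : x + 8 ≤ 0),
      max_zero_of_nonpos (by linarith : x + 2 ≤ 0), max_zero_of_nonpos (by linarith : x ≤ 0),
      max_zero_of_nonpos (by linarith : x - 2 ≤ 0)]; ring
  rcases le_total x (-8) with h2 | h2'
  · refine Or.inr (Or.inr (Or.inl ⟨h1', h2, ?_⟩))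
    rw [ceilFn, max_zero_of_nonneg (by linarith : 0 ≤ x + 32),
      max_zero_of_nonneg (by linarith : 0 ≤ x + 12), max_zero_of_nonpos (by linarith : x + 8 ≤ 0),
      max_zero_of_nonpos (by linarith : x + 2 ≤ 0), max_zero_of_nonpos (by linarith : x ≤ 0),
      max_zero_of_nonpos (by linarith : x - 2 ≤ 0)]; ring
  rcases le_total x (-2) with h3 | h3'
  · refine Or.inr (Or.inr (Or.inr (Or.inl ⟨h2', h3, ?_⟩)))
    rw [ceilFn, max_zero_of_nonneg (by linarith : 0 ≤ x + 32),
      max_zero_of_nonneg (by linarith : 0 ≤ x + 12), max_zero_of_nonneg (by linarith : 0 ≤ x + 8),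
      max_zero_of_nonpos (by linarith : x + 2 ≤ 0), max_zero_of_nonpos (by linarith : x ≤ 0),
      max_zero_of_nonpos (by linarith : x - 2 ≤ 0)]; ring
  rcases le_total x (0) with h4 | h4'
  · refine Or.inr (Or.inr (Or.inr (Or.inr (Or.inl ⟨h3', h4, ?_⟩))))
    rw [ceilFn, max_zero_of_nonneg (by linarith : 0 ≤ x + 32),
      max_zero_of_nonneg (by linarith : 0 ≤ x + 12), max_zero_of_nonneg (by linarith : 0 ≤ x + 8),
      max_zero_of_nonneg (by linarith : 0 ≤ x + 2), max_zero_of_nonpos (by linarith : x ≤ 0),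
      max_zero_of_nonpos (by linarith : x - 2 ≤ 0)]; ring
  rcases le_total x (2) with h5 | h5'
  · refine Or.inr (Or.inr (Or.inr (Or.inr (Or.inr (Or.inl ⟨h4', h5, ?_⟩)))))
    rw [ceilFn, max_zero_of_nonneg (by linarith : 0 ≤ x + 32),
      max_zero_of_nonneg (by linarith : 0 ≤ x + 12), max_zero_of_nonneg (by linarith : 0 ≤ x + 8),
      max_zero_of_nonneg (by linarith : 0 ≤ x + 2), max_zero_of_nonneg (by linarith : 0 ≤ x),
      max_zero_of_nonpos (by linarith : x - 2 ≤ 0)]; ring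
  refine Or.inr (Or.inr (Or.inr (Or.inr (Or.inr (Or.inr ⟨h5', ?_⟩)))))
  rw [ceilFn, max_zero_of_nonneg (by linarith : 0 ≤ x + 32),
    max_zero_of_nonneg (by linarith : 0 ≤ x + 12), max_zero_of_nonneg (by linarith : 0 ≤ x + 8),
    max_zero_of_nonneg (by linarith : 0 ≤ x + 2), max_zero_of_nonneg (by linarith : 0 ≤ x),
    max_zero_of_nonneg (by linarith : 0 ≤ x - 2)]; ring

lemma floorFn_neg (x : ℝ) : floorFn x < 0 := by
  rcases floorFn_cases x with h | h | h | h | h | h <;> linarith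

lemma ceilFn_pos (x : ℝ) : 0 < ceilFn x := by
  rcases ceilFn_cases x with h | h | h | h | h | h | h <;> linarith

lemma floorFn_lt_ceilFn (x : ℝ) : floorFn x < ceilFn x := (floorFn_neg x).trans (ceilFn_pos x)

/-- The vertices of the polygon in counterclockwise order. -/
def vertex : Fin 15 → ℤ × ℤ :=
  ![(-34, -1), (-27, -1), (-7, -11), (-6, -320), (-2, -40), (2, -20), (12, -620), (12, 30),
    (2, 20), (0, 200), (-2, 40), (-8, 10), (-12, 50), (-32, 1), (-34, 1)]

/-- The edge of the polygon starting at a given vertex. -/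
def edge (i : Fin 15) : Pt × Pt := (toPt (vertex i), toPt (vertex (i + 1)))

lemma vertex_injective : Function.Injective vertex := by
  unfold Function.Injective; decide

lemma edge_injective : Function.Injective edge := fun _ _ h =>
  vertex_injective (toPt_injective (congrArg Prod.fst h))

set_option maxRecDepth 4000 in
lemma edge_separation (i j : Fin 15) : i = j ∨
    j = i + 1 ∧ orient (vertex i) (vertex (i + 1)) (vertex (j + 1)) ≠ 0 ∨
    i = j + 1 ∧ orient (vertex j) (vertex (j + 1)) (vertex (i + 1)) ≠ 0 ∨
    OnOneSide (vertex i) (vertex (i + 1)) (vertex j) (vertex (j + 1)) ∨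
    OnOneSide (vertex j) (vertex (j + 1)) (vertex i) (vertex (i + 1)) := by
  revert i j; decide

lemma exists_edge_iff (S : Pt → Pt → Set Pt) (hS : ∀ a b, S a b = S b a) (p : Pt) :
    (∃ i, p ∈ S (edge i).1 (edge i).2) ↔
      p ∈ S (toPt (-34, -1)) (toPt (-27, -1)) ∨
      p ∈ S (toPt (-27, -1)) (toPt (-7, -11)) ∨
      p ∈ S (toPt (-7, -11)) (toPt (-6, -320)) ∨
      p ∈ S (toPt (-6, -320)) (toPt (-2, -40)) ∨
      p ∈ S (toPt (-2, -40)) (toPt (2, -20)) ∨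
      p ∈ S (toPt (2, -20)) (toPt (12, -620)) ∨
      p ∈ S (toPt (12, -620)) (toPt (12, 30)) ∨
      p ∈ S (toPt (2, 20)) (toPt (12, 30)) ∨
      p ∈ S (toPt (0, 200)) (toPt (2, 20)) ∨
      p ∈ S (toPt (-2, 40)) (toPt (0, 200)) ∨
      p ∈ S (toPt (-8, 10)) (toPt (-2, 40)) ∨
      p ∈ S (toPt (-12, 50)) (toPt (-8, 10)) ∨
      p ∈ S (toPt (-32, 1)) (toPt (-12, 50)) ∨
      p ∈ S (toPt (-34, 1)) (toPt (-32, 1)) ∨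
      p ∈ S (toPt (-34, -1)) (toPt (-34, 1)) := by
  rw [hS (toPt (2, 20)), hS (toPt (0, 200)), hS (toPt (-2, 40)), hS (toPt (-8, 10)),
    hS (toPt (-12, 50)), hS (toPt (-32, 1)), hS (toPt (-34, 1)),
    hS (toPt (-34, -1)) (toPt (-34, 1))]
  constructor
  · rintro ⟨i, hi⟩
    fin_cases i
    · left; exact hi
    · (iterate 1 right); left; exact hi
    · (iterate 2 right); left; exact hi
    · (iterate 3 right); left; exact hi
    · (iterate 4 right); left; exact hi
    · (iterate 5 right); left; exact hi
    · (iterate 6 right); left; exact hi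
    · (iterate 7 right); left; exact hi
    · (iterate 8 right); left; exact hi
    · (iterate 9 right); left; exact hi
    · (iterate 10 right); left; exact hi
    · (iterate 11 right); left; exact hi
    · (iterate 12 right); left; exact hi
    · (iterate 13 right); left; exact hi
    · (iterate 14 right); exact hi
  · rintro (h | h | h | h | h | h | h | h | h | h | h | h | h | h | h)
    exacts [⟨0, h⟩, ⟨1, h⟩, ⟨2, h⟩, ⟨3, h⟩, ⟨4, h⟩, ⟨5, h⟩, ⟨6, h⟩, ⟨7, h⟩, ⟨8, h⟩, ⟨9, h⟩,
      ⟨10, h⟩, ⟨11, h⟩, ⟨12, h⟩, ⟨13, h⟩, ⟨14, h⟩]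

/-- The polygonal region. -/
def polygonRegion : Set Pt := regionBetweenGraphs floorFn ceilFn (-34) 12

lemma mem_frontier_polygonRegion {p : Pt} : p ∈ frontier polygonRegion ↔
    p ∈ polygonRegion ∧
      (p 0 = -34 ∨ p 0 = 12 ∨ p 1 = floorFn (p 0) ∨ p 1 = ceilFn (p 0)) :=
  mem_frontier_regionBetweenGraphs continuous_floorFn continuous_ceilFn
    fun x _ _ => floorFn_lt_ceilFn x

lemma mem_frontier_of_eq_floorFn {p : Pt} (hl : -34 ≤ p 0) (hr : p 0 ≤ 12)
    (h : p 1 = floorFn (p 0)) : p ∈ frontier polygonRegion :=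
  mem_frontier_polygonRegion.2
    ⟨⟨hl, hr, h.ge, h.trans_le (floorFn_lt_ceilFn _).le⟩, Or.inr (Or.inr (Or.inl h))⟩

lemma mem_frontier_of_eq_ceilFn {p : Pt} (hl : -34 ≤ p 0) (hr : p 0 ≤ 12)
    (h : p 1 = ceilFn (p 0)) : p ∈ frontier polygonRegion :=
  mem_frontier_polygonRegion.2
    ⟨⟨hl, hr, (floorFn_lt_ceilFn _).le.trans h.ge, h.le⟩, Or.inr (Or.inr (Or.inr h))⟩

lemma mem_edge_of_mem_frontier {p : Pt} (h : p ∈ frontier polygonRegion) :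
    ∃ i, p ∈ segment ℝ (edge i).1 (edge i).2 := by
  rw [exists_edge_iff _ (segment_symm ℝ)]
  obtain ⟨⟨hl, hr, h1, h2⟩, h⟩ := mem_frontier_polygonRegion.1 h
  have hfl := floorFn_cases (p 0)
  have hce := ceilFn_cases (p 0)
  rcases h with h | h | h | h
  · iterate 14 right
    rw [mem_segment_toPt_vertical_iff (by norm_num)]
    norm_num
    refine ⟨h, ?_, ?_⟩
    · rcases hfl with h | h | h | h | h | h <;> linarith
    · rcases hce with h | h | h | h | h | h | h <;> linarith
  · iterate 6 right
    left
    rw [mem_segment_toPt_vertical_iff (by norm_num)]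
    norm_num
    refine ⟨h, ?_, ?_⟩
    · rcases hfl with h | h | h | h | h | h <;> linarith
    · rcases hce with h | h | h | h | h | h | h <;> linarith
  · rw [← h] at hfl
    rcases hfl with ⟨h4, h5⟩ | ⟨h3, h4, h5⟩ | ⟨h3, h4, h5⟩ | ⟨h3, h4, h5⟩ | ⟨h3, h4, h5⟩ |
      ⟨h4, h5⟩
    · left
      rw [mem_segment_toPt_iff (by norm_num)]
      norm_num
      exact ⟨hl, h4, by linarith⟩
    · iterate 1 right
      left
      rw [mem_segment_toPt_iff (by norm_num)]
      norm_num
      exact ⟨h3, h4, by linarith⟩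
    · iterate 2 right
      left
      rw [mem_segment_toPt_iff (by norm_num)]
      norm_num
      exact ⟨h3, h4, by linarith⟩
    · iterate 3 right
      left
      rw [mem_segment_toPt_iff (by norm_num)]
      norm_num
      exact ⟨h3, h4, by linarith⟩
    · iterate 4 right
      left
      rw [mem_segment_toPt_iff (by norm_num)]
      norm_num
      exact ⟨h3, h4, by linarith⟩
    · iterate 5 right
      left
      rw [mem_segment_toPt_iff (by norm_num)]
      norm_num
      exact ⟨h4, hr, by linarith⟩
  · rw [← h] at hce
    rcases hce with ⟨h4, h5⟩ | ⟨h3, h4, h5⟩ | ⟨h3, h4, h5⟩ | ⟨h3, h4, h5⟩ | ⟨h3, h4, h5⟩ |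
      ⟨h3, h4, h5⟩ | ⟨h4, h5⟩
    · iterate 13 right
      left
      rw [mem_segment_toPt_iff (by norm_num)]
      norm_num
      exact ⟨hl, h4, by linarith⟩
    · iterate 12 right
      left
      rw [mem_segment_toPt_iff (by norm_num)]
      norm_num
      exact ⟨h3, h4, by linarith⟩
    · iterate 11 right
      left
      rw [mem_segment_toPt_iff (by norm_num)]
      norm_num
      exact ⟨h3, h4, by linarith⟩
    · iterate 10 right
      left
      rw [mem_segment_toPt_iff (by norm_num)]
      norm_num
      exact ⟨h3, h4, by linarith⟩
    · iterate 9 right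
      left
      rw [mem_segment_toPt_iff (by norm_num)]
      norm_num
      exact ⟨h3, h4, by linarith⟩
    · iterate 8 right
      left
      rw [mem_segment_toPt_iff (by norm_num)]
      norm_num
      exact ⟨h3, h4, by linarith⟩
    · iterate 7 right
      left
      rw [mem_segment_toPt_iff (by norm_num)]
      norm_num
      exact ⟨h4, hr, by linarith⟩

lemma mem_frontier_of_mem_edge {p : Pt} (h : ∃ i, p ∈ segment ℝ (edge i).1 (edge i).2) :
    p ∈ frontier polygonRegion := by
  rw [exists_edge_iff _ (segment_symm ℝ)] at h
  have hfl := floorFn_cases (p 0)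
  have hce := ceilFn_cases (p 0)
  rcases h with h | h | h | h | h | h | h | h | h | h | h | h | h | h | h
  on_goal 7 =>
    rw [mem_segment_toPt_vertical_iff (by norm_num)] at h
    norm_num at h
    refine mem_frontier_polygonRegion.2 ⟨⟨by linarith, by linarith, ?_, ?_⟩, Or.inr (Or.inl h.1)⟩
    · rcases hfl with h | h | h | h | h | h <;> linarith
    · rcases hce with h | h | h | h | h | h | h <;> linarith
  on_goal 14 =>
    rw [mem_segment_toPt_vertical_iff (by norm_num)] at h
    norm_num at h
    refine mem_frontier_polygonRegion.2 ⟨⟨by linarith, by linarith, ?_, ?_⟩, Or.inl h.1⟩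
    · rcases hfl with h | h | h | h | h | h <;> linarith
    · rcases hce with h | h | h | h | h | h | h <;> linarith
  all_goals
    rw [mem_segment_toPt_iff (by norm_num)] at h
    norm_num at h
    obtain ⟨h1, h2, h3⟩ := h
  iterate 6
    refine mem_frontier_of_eq_floorFn (by linarith) (by linarith) ?_
    rcases hfl with h | h | h | h | h | h <;> linarith
  iterate 7
    refine mem_frontier_of_eq_ceilFn (by linarith) (by linarith) ?_
    rcases hce with h | h | h | h | h | h | h <;> linarith

/-- The simple polygon of the construction. -/
def polygon : SimplePolygon where
  carrier := polygonRegion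
  edges := Finset.univ.map ⟨edge, edge_injective⟩
  isCompact := isCompact_regionBetweenGraphs continuous_floorFn continuous_ceilFn
    fun x _ _ => floorFn_lt_ceilFn x
  interior_nonempty := (isConnected_interior_regionBetweenGraphs continuous_floorFn
    continuous_ceilFn (by norm_num) fun x _ _ => floorFn_lt_ceilFn x).nonempty
  interior_connected := isConnected_interior_regionBetweenGraphs continuous_floorFn
    continuous_ceilFn (by norm_num) fun x _ _ => floorFn_lt_ceilFn x
  edges_nondeg := by
    intro e he h
    obtain ⟨i, -, rfl⟩ := Finset.mem_map.1 he
    have h' : i = i + 1 := vertex_injective (toPt_injective h)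
    exact absurd h' (by clear he h h'; revert i; decide)
  frontier_eq := by
    ext p
    have : p ∈ frontier polygonRegion ↔ ∃ i, p ∈ segment ℝ (edge i).1 (edge i).2 :=
      ⟨mem_edge_of_mem_frontier, mem_frontier_of_mem_edge⟩
    simpa using this
  edges_meet := by
    intro e he f hf hef
    obtain ⟨i, -, rfl⟩ := Finset.mem_map.1 he
    obtain ⟨j, -, rfl⟩ := Finset.mem_map.1 hf
    simp only [Function.Embedding.coeFn_mk, edge]
    rcases edge_separation i j with rfl | ⟨rfl, h⟩ | ⟨rfl, h⟩ | h | h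
    · exact absurd rfl hef
    · refine (segment_inter_subset_of_orient_ne_zero h).trans ?_
      rintro _ rfl
      simp
    · rw [inter_comm]
      refine (segment_inter_subset_of_orient_ne_zero h).trans ?_
      rintro _ rfl
      simp
    · simp [h.segment_inter_eq_empty]
    · rw [inter_comm, h.segment_inter_eq_empty]; exact empty_subset _
  vertex_deg_two := by
    intro e he v hv
    obtain ⟨i, -, rfl⟩ := Finset.mem_map.1 he
    obtain ⟨k, rfl⟩ : ∃ k, v = toPt (vertex k) := by
      rcases hv with rfl | rfl
      · exact ⟨i, rfl⟩
      · exact ⟨i + 1, rfl⟩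
    have : {f | f ∈ Finset.univ.map ⟨edge, edge_injective⟩ ∧
        (toPt (vertex k) = f.1 ∨ toPt (vertex k) = f.2)} = {edge k, edge (k - 1)} := by
      ext f
      constructor
      · rintro ⟨hf, h⟩
        obtain ⟨j, -, rfl⟩ := Finset.mem_map.1 hf
        rcases h with h | h
        · obtain rfl : k = j := vertex_injective (toPt_injective h)
          exact Or.inl rfl
        · obtain rfl : k = j + 1 := vertex_injective (toPt_injective h)
          exact Or.inr (by simp)
      · rintro (rfl | rfl)
        · exact ⟨by simp, Or.inl rfl⟩
        · exact ⟨by simp, Or.inr (by simp [edge])⟩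
    rw [this, ncard_pair]
    have hk : ∀ k : Fin 15, k ≠ k - 1 := by decide
    exact edge_injective.ne (hk k)
  frontier_connected := isConnected_frontier_regionBetweenGraphs continuous_floorFn
    continuous_ceilFn (by norm_num) fun x _ _ => floorFn_lt_ceilFn x

/-! ### Sight lines -/

lemma onEdgeInterior_cases {p : Pt} (h : OnEdgeInterior polygon p) :
    -34 < p 0 ∧ p 0 < -27 ∧ p 1 = -1 ∨
    -27 < p 0 ∧ p 0 < -7 ∧ p 1 = -1 - (p 0 + 27) / 2 ∨
    -7 < p 0 ∧ p 0 < -6 ∧ p 1 = -11 - 309 * (p 0 + 7) ∨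
    -6 < p 0 ∧ p 0 < -2 ∧ p 1 = -40 + 70 * (p 0 + 2) ∨
    -2 < p 0 ∧ p 0 < 2 ∧ p 1 = -20 + 5 * (p 0 - 2) ∨
    2 < p 0 ∧ p 0 < 12 ∧ p 1 = -20 - 60 * (p 0 - 2) ∨
    p 0 = 12 ∨
    2 < p 0 ∧ p 0 < 12 ∧ p 1 = 20 + (p 0 - 2) ∨
    0 < p 0 ∧ p 0 < 2 ∧ p 1 = 200 - 90 * p 0 ∨
    -2 < p 0 ∧ p 0 < 0 ∧ p 1 = 200 + 80 * p 0 ∨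
    -8 < p 0 ∧ p 0 < -2 ∧ p 1 = 10 + 5 * (p 0 + 8) ∨
    -12 < p 0 ∧ p 0 < -8 ∧ p 1 = 10 - 10 * (p 0 + 8) ∨
    -32 < p 0 ∧ p 0 < -12 ∧ p 1 = 1 + 49 / 20 * (p 0 + 32) ∨
    -34 < p 0 ∧ p 0 < -32 ∧ p 1 = 1 ∨
    p 0 = -34 ∧ -1 < p 1 ∧ p 1 < 1 := by
  obtain ⟨e, he, hp⟩ := h
  obtain ⟨i, -, rfl⟩ := Finset.mem_map.1 he
  have h : ∃ i, p ∈ openSegment ℝ (edge i).1 (edge i).2 := ⟨i, hp⟩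
  rw [exists_edge_iff _ (openSegment_symm ℝ)] at h
  revert h
  refine Or.imp ?_ (Or.imp ?_ (Or.imp ?_ (Or.imp ?_ (Or.imp ?_ (Or.imp ?_
    (Or.imp ?_ (Or.imp ?_ (Or.imp ?_ (Or.imp ?_ (Or.imp ?_
    (Or.imp ?_ (Or.imp ?_ (Or.imp ?_ ?_)))))))))))))
  on_goal 7 =>
    intro h
    rw [mem_openSegment_toPt_vertical_iff (by norm_num)] at h
    norm_num at h
    exact h.1
  on_goal 14 =>
    intro h
    rw [mem_openSegment_toPt_vertical_iff (by norm_num)] at h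
    norm_num at h
    exact h
  all_goals
    intro h
    rw [mem_openSegment_toPt_iff (by norm_num)] at h
    norm_num at h
    exact ⟨h.1, h.2.1, by linarith [h.2.2]⟩

lemma exists_sight_line {q p : Pt} (h : MutuallyVisible polygonRegion q p) (hqp : q 0 < p 0) :
    ∃ m k : ℝ, q 1 = m * q 0 + k ∧ p 1 = m * p 0 + k ∧
      ∀ c, q 0 < c → c < p 0 → floorFn c < m * c + k ∧ m * c + k < ceilFn c :=
  h.exists_line continuous_floorFn continuous_ceilFn hqp

lemma floorFn_neg_twenty_seven : floorFn (-27) = -1 := by norm_num [floorFn]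
lemma floorFn_neg_seven : floorFn (-7) = -11 := by norm_num [floorFn]
lemma floorFn_neg_two : floorFn (-2) = -40 := by norm_num [floorFn]
lemma floorFn_two : floorFn 2 = -20 := by norm_num [floorFn]
lemma ceilFn_neg_thirty_two : ceilFn (-32) = 1 := by norm_num [ceilFn]
lemma ceilFn_neg_eight : ceilFn (-8) = 10 := by norm_num [ceilFn]
lemma ceilFn_neg_two : ceilFn (-2) = 40 := by norm_num [ceilFn]
lemma ceilFn_two : ceilFn 2 = 20 := by norm_num [ceilFn]

/-- The light source. -/
def source : Pt := toPt (-33, 0)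

/-- A point in the blind spot. -/
def blindPoint : Pt := toPt (0, 100)

lemma bounds_of_visible_from_niche {q p : Pt} (h : MutuallyVisible polygonRegion q p)
    (hq : q 0 ≤ -27) (hl : -1 ≤ q 1) (hu : q 1 ≤ 1) (hp : -7 < p 0) :
    p 1 < 10 + 11 / 19 * (p 0 + 8) ∧ -11 - 3 / 5 * (p 0 + 7) < p 1 := by
  obtain ⟨m, k, h1, h2, h3⟩ := exists_sight_line h (by linarith)
  have a := (h3 (-8) (by linarith) (by linarith)).2
  have b := (h3 (-7) (by linarith) (by linarith)).1
  rw [ceilFn_neg_eight] at a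
  rw [floorFn_neg_seven] at b
  have hm : m < 11 / 19 := by
    by_contra! hm
    nlinarith
  have hm' : -3 / 5 < m := by
    by_contra! hm
    nlinarith
  constructor <;> nlinarith

/-- The part of the boundary containing every edge point seen from the source. -/
def Lit (q : Pt) : Prop :=
  q 0 ≤ -27 ∧ -1 ≤ q 1 ∧ q 1 ≤ 1 ∨
  -12 < q 0 ∧ q 0 < -8 ∧ q 1 = 10 - 10 * (q 0 + 8) ∨
  q 0 = 12 ∧ -24 ≤ q 1 ∧ q 1 ≤ 24

/-- The part of the boundary containing every edge point seen from the blind point. -/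
def SeesBlindPoint (p : Pt) : Prop :=
  -7 < p 0 ∧ p 0 < -6 ∧ p 1 = -11 - 309 * (p 0 + 7) ∧ p 1 < 40 + 30 * (p 0 + 2) ∨
  -2 < p 0 ∧ p 0 < 2 ∧ p 1 = -20 + 5 * (p 0 - 2) ∨
  0 < p 0 ∧ p 0 < 2 ∧ p 1 = 200 - 90 * p 0 ∨
  -2 < p 0 ∧ p 0 < 0 ∧ p 1 = 200 + 80 * p 0 ∨
  p 0 = 12 ∧ p 1 < -24

lemma lit_of_visible {q : Pt} (hq : OnEdgeInterior polygon q)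
    (h : MutuallyVisible polygonRegion source q) : Lit q := by
  have s0 : source 0 = -33 := by norm_num [source]
  have s1 : source 1 = 0 := by norm_num [source]
  have hn := bounds_of_visible_from_niche h (by linarith) (by linarith) (by linarith)
  rcases onEdgeInterior_cases hq with ⟨a, b, c⟩ | ⟨a, b, c⟩ | ⟨a, b, c⟩ | ⟨a, b, c⟩ | ⟨a, b, c⟩ |
    ⟨a, b, c⟩ | a | ⟨a, b, c⟩ | ⟨a, b, c⟩ | ⟨a, b, c⟩ | ⟨a, b, c⟩ | ⟨a, b, c⟩ | ⟨a, b, c⟩ |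
    ⟨a, b, c⟩ | ⟨a, b, c⟩
  · exact Or.inl ⟨by linarith, by linarith, by linarith⟩
  · exfalso
    obtain ⟨m, k, h1, h2, h3⟩ := exists_sight_line h (by linarith)
    have d := (h3 (-27) (by linarith) (by linarith)).1
    rw [floorFn_neg_twenty_seven] at d
    rw [s0, s1] at h1
    have hm : -1 / 6 < m := by linarith
    nlinarith
  · exfalso; linarith [hn (by linarith)]
  · exfalso; linarith [hn (by linarith)]
  · exfalso; linarith [hn (by linarith)]
  · exfalso; linarith [hn (by linarith)]
  · have := hn (by linarith)
    exact Or.inr (Or.inr ⟨a, by linarith, by linarith⟩)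
  · exfalso; linarith [hn (by linarith)]
  · exfalso; linarith [hn (by linarith)]
  · exfalso; linarith [hn (by linarith)]
  · obtain ⟨m, k, h1, h2, h3⟩ := exists_sight_line h (by linarith)
    have d := (h3 (-8) (by linarith) (by linarith)).2
    rw [ceilFn_neg_eight] at d
    rw [s0, s1] at h1
    have hm : m < 2 / 5 := by linarith
    nlinarith
  · exact Or.inr (Or.inl ⟨a, b, c⟩)
  · exfalso
    obtain ⟨m, k, h1, h2, h3⟩ := exists_sight_line h (by linarith)
    have d := (h3 (-32) (by linarith) (by linarith)).2
    rw [ceilFn_neg_thirty_two] at d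
    rw [s0, s1] at h1
    have hm : m < 1 := by linarith
    nlinarith
  · exact Or.inl ⟨by linarith, by linarith, by linarith⟩
  · exact Or.inl ⟨by linarith, by linarith, by linarith⟩

lemma seesBlindPoint_of_visible {p : Pt} (hp : OnEdgeInterior polygon p)
    (h : MutuallyVisible polygonRegion p blindPoint) : SeesBlindPoint p := by
  have x0 : blindPoint 0 = 0 := by norm_num [blindPoint]
  have x1 : blindPoint 1 = 100 := by norm_num [blindPoint]
  have hleft : p 0 < -2 → ∃ m, 30 < m ∧ m < 70 ∧ p 1 = m * p 0 + 100 ∧ -7 ≤ p 0 := by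
    intro hlt
    obtain ⟨m, k, h1, h2, h3⟩ := exists_sight_line h (by linarith)
    have a := h3 (-2) (by linarith) (by linarith)
    rw [ceilFn_neg_two, floorFn_neg_two] at a
    rw [x0, x1] at h2
    refine ⟨m, by linarith, by linarith, by linarith, ?_⟩
    by_contra! h7
    have b := (h3 (-7) (by linarith) (by linarith)).1
    rw [floorFn_neg_seven] at b
    linarith
  have hright : 2 < p 0 → ∃ m, -60 < m ∧ m < -40 ∧ p 1 = m * p 0 + 100 := by
    intro hlt
    obtain ⟨m, k, h1, h2, h3⟩ := exists_sight_line h.symm (by linarith)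
    have a := h3 2 (by linarith) (by linarith)
    rw [ceilFn_two, floorFn_two] at a
    rw [x0, x1] at h1
    exact ⟨m, by linarith, by linarith, by linarith⟩
  rcases onEdgeInterior_cases hp with ⟨a, b, c⟩ | ⟨a, b, c⟩ | ⟨a, b, c⟩ | ⟨a, b, c⟩ | ⟨a, b, c⟩ |
    ⟨a, b, c⟩ | a | ⟨a, b, c⟩ | ⟨a, b, c⟩ | ⟨a, b, c⟩ | ⟨a, b, c⟩ | ⟨a, b, c⟩ | ⟨a, b, c⟩ |
    ⟨a, b, c⟩ | ⟨a, b, c⟩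
  · obtain ⟨m, -, -, -, h4⟩ := hleft (by linarith); linarith
  · obtain ⟨m, -, -, -, h4⟩ := hleft (by linarith); linarith
  · obtain ⟨m, h1, h2, h3, -⟩ := hleft (by linarith)
    exact Or.inl ⟨a, b, c, by nlinarith⟩
  · obtain ⟨m, h1, h2, h3, -⟩ := hleft (by linarith); nlinarith
  · exact Or.inr (Or.inl ⟨a, b, c⟩)
  · obtain ⟨m, h1, h2, h3⟩ := hright (by linarith); nlinarith
  · obtain ⟨m, h1, h2, h3⟩ := hright (by linarith)
    refine Or.inr (Or.inr (Or.inr (Or.inr ⟨a, ?_⟩)))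
    rw [a] at h3
    linarith
  · obtain ⟨m, h1, h2, h3⟩ := hright (by linarith); nlinarith
  · exact Or.inr (Or.inr (Or.inl ⟨a, b, c⟩))
  · exact Or.inr (Or.inr (Or.inr (Or.inl ⟨a, b, c⟩)))
  · obtain ⟨m, h1, h2, h3, -⟩ := hleft (by linarith); nlinarith
  all_goals obtain ⟨m, -, -, -, h4⟩ := hleft (by linarith); linarith

lemma Lit.not_seesBlindPoint {p : Pt} (hl : Lit p) (hs : SeesBlindPoint p) : False := by
  rcases hl with h | h | h <;> rcases hs with h' | h' | h' | h' | h' <;> linarith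

lemma Lit.not_visible_of_seesBlindPoint {q p : Pt} (hl : Lit q) (hs : SeesBlindPoint p)
    (h : MutuallyVisible polygonRegion q p) : False := by
  rcases hl with ⟨a, b, c⟩ | ⟨a, b, c⟩ | ⟨a, b, c⟩
  · have hn := bounds_of_visible_from_niche h a b c
    rcases hs with h' | h' | h' | h' | h' <;> linarith [hn (by linarith)]
  · have hp : -7 < p 0 := by rcases hs with h' | h' | h' | h' | h' <;> linarith
    obtain ⟨m, k, h1, h2, h3⟩ := exists_sight_line h (by linarith)
    have d := (h3 (-8) (by linarith) (by linarith)).2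
    have d' := (h3 (-7) (by linarith) (by linarith)).1
    rw [ceilFn_neg_eight] at d
    rw [floorFn_neg_seven] at d'
    have hm : m < -10 := by
      by_contra! hm
      nlinarith
    by_cases hp2 : -2 < p 0
    · have e := (h3 (-2) (by linarith) (by linarith)).1
      rw [floorFn_neg_two] at e
      linarith
    · have hm' : -21 < m := by
        by_contra! hm'
        nlinarith
      rcases hs with h' | h' | h' | h' | h' <;> nlinarith
  · have hlt : p 0 < q 0 := by
      rcases hs with h' | h' | h' | h' | ⟨h', -⟩
      iterate 4 linarith
      exfalso
      have hmid := h.2.2 ⟨1 / 2, 1 / 2, by norm_num, by norm_num, by norm_num, rfl⟩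
      rw [polygonRegion, interior_regionBetweenGraphs continuous_floorFn continuous_ceilFn] at hmid
      have := hmid.2.1
      simp only [PiLp.add_apply, PiLp.smul_apply, smul_eq_mul] at this
      linarith
    obtain ⟨m, k, h1, h2, h3⟩ := exists_sight_line h.symm hlt
    have hp2 : p 0 < 2 := by rcases hs with h' | h' | h' | h' | h' <;> linarith
    have d := h3 2 hp2 (by linarith)
    rw [floorFn_two, ceilFn_two] at d
    rw [a] at h2
    have hm : m < 22 / 5 := by linarith
    have hm' : -22 / 5 < m := by linarith
    rcases hs with h' | h' | h' | h' | h'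
    · have e := (h3 (-2) (by linarith) (by linarith)).1
      rw [floorFn_neg_two] at e
      nlinarith
    all_goals nlinarith

lemma blindPoint_notMem_Vk : blindPoint ∉ Vk polygon source 2 := by
  rintro ⟨-, l, hl, c, h0, h1, he, hv⟩
  change ∀ i ≤ l, MutuallyVisible polygonRegion (c i) (c (i + 1)) at hv
  have s0 : source 0 = -33 := by norm_num [source]
  have s1 : source 1 = 0 := by norm_num [source]
  have x0 : blindPoint 0 = 0 := by norm_num [blindPoint]
  have x1 : blindPoint 1 = 100 := by norm_num [blindPoint]
  interval_cases l
  · have h := hv 0 le_rfl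
    rw [h0, h1] at h
    have := bounds_of_visible_from_niche h (by linarith) (by linarith) (by linarith) (by linarith)
    linarith
  · have h := hv 0 (by norm_num)
    have h' := hv 1 le_rfl
    rw [h0] at h
    rw [h1] at h'
    have hc := he 1 le_rfl le_rfl
    exact (lit_of_visible hc h).not_seesBlindPoint (seesBlindPoint_of_visible hc h')
  · have h := hv 0 (by norm_num)
    have h' := hv 2 le_rfl
    rw [h0] at h
    rw [h1] at h'
    exact (lit_of_visible (he 1 le_rfl (by norm_num)) h).not_visible_of_seesBlindPoint
      (seesBlindPoint_of_visible (he 2 (by norm_num) le_rfl) h') (hv 1 (by norm_num))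

/-! ### The lit loop around the blind point -/

lemma visible_of_line {q p : Pt} (m k : ℝ)
    (hqp : q 0 < p 0) (hl : -34 ≤ q 0) (hr : p 0 ≤ 12) (hq : q 1 = m * q 0 + k)
    (hp : p 1 = m * p 0 + k)
    (h : ∀ c, q 0 ≤ c → c ≤ p 0 → floorFn c ≤ m * c + k ∧ m * c + k ≤ ceilFn c)
    (h' : ∀ c, q 0 < c → c < p 0 → floorFn c < m * c + k ∧ m * c + k < ceilFn c) :
    MutuallyVisible polygonRegion q p :=
  mutuallyVisible_of_line continuous_floorFn continuous_ceilFn m k hqp hl hr hq hp h h'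

lemma onEdgeInterior_of_mem {p : Pt} (h : ∃ i, p ∈ openSegment ℝ (edge i).1 (edge i).2) :
    OnEdgeInterior polygon p := by
  obtain ⟨i, hi⟩ := h
  exact ⟨edge i, Finset.mem_map.2 ⟨i, Finset.mem_univ _, rfl⟩, hi⟩

lemma mem_Vk_of_visible {Q : SimplePolygon} {s y : Pt} {k : ℕ}
    (h : MutuallyVisible Q.carrier s y) : y ∈ Vk Q s k := by
  refine ⟨h.2.1, 0, Nat.zero_le _, fun i => if i = 0 then s else y, by simp, by simp, ?_, ?_⟩
  · intro i h1 h2; omega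
  · intro i hi
    obtain rfl : i = 0 := by omega
    simpa using h

lemma mem_Vk_two_of_visible {Q : SimplePolygon} {s q p y : Pt} (hq : OnEdgeInterior Q q)
    (hp : OnEdgeInterior Q p) (h1 : MutuallyVisible Q.carrier s q)
    (h2 : MutuallyVisible Q.carrier q p) (h3 : MutuallyVisible Q.carrier p y) :
    y ∈ Vk Q s 2 := by
  refine ⟨h3.2.1, 2, le_rfl,
    fun i => if i = 0 then s else if i = 1 then q else if i = 2 then p else y,
    by simp, by simp, ?_, ?_⟩
  · intro i hi hi'
    interval_cases i
    · simpa using hq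
    · simpa using hp
  · intro i hi
    interval_cases i
    · simpa using h1
    · simpa using h2
    · simpa using h3

lemma mem_Vk_of_eq_zero {y : Pt} (h1 : y 1 = 0) (h0 : -2 < y 0) (h2 : y 0 < 12) :
    y ∈ Vk polygon source 2 := by
  have s0 : source 0 = -33 := by norm_num [source]
  have s1 : source 1 = 0 := by norm_num [source]
  refine mem_Vk_of_visible (visible_of_line 0 0 (by linarith) (by linarith) (by linarith)
    (by linarith) (by linarith) ?_ ?_)
  · intro c _ _
    have := floorFn_neg c
    have := ceilFn_pos c
    constructor <;> linarith
  · intro c _ _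
    have := floorFn_neg c
    have := ceilFn_pos c
    constructor <;> linarith

lemma mem_Vk_of_right_side {y : Pt} (h : y 1 = 140 - 70 * y 0) (hl : 16 / 150 ≤ y 0)
    (hr : y 0 ≤ 2) : y ∈ Vk polygon source 2 := by
  have s0 : source 0 = -33 := by norm_num [source]
  have s1 : source 1 = 0 := by norm_num [source]
  refine mem_Vk_two_of_visible (q := toPt (12, 0)) (p := toPt (4, -140))
    (onEdgeInterior_of_mem ⟨6, ?_⟩) (onEdgeInterior_of_mem ⟨5, ?_⟩)
    (visible_of_line 0 0 ?_ ?_ ?_ ?_ ?_ ?_ ?_)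
    (visible_of_line (35 / 2) (-210) ?_ ?_ ?_ ?_ ?_ ?_ ?_).symm
    (visible_of_line (-70) 140 ?_ ?_ ?_ ?_ ?_ ?_ ?_).symm
  · exact (mem_openSegment_toPt_vertical_iff (by norm_num)).2 (by norm_num)
  · exact (mem_openSegment_toPt_iff (a := (2, -20)) (b := (12, -620)) (by norm_num)).2
      (by norm_num)
  all_goals norm_num [s0, s1]
  · intro c _ _
    exact ⟨(floorFn_neg c).le, (ceilFn_pos c).le⟩
  · intro c _ _
    exact ⟨floorFn_neg c, ceilFn_pos c⟩
  · intro c h1 h2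
    constructor
    · rcases floorFn_cases c with h | h | h | h | h | h <;> linarith
    · linarith [ceilFn_pos c]
  · intro c h1 h2
    constructor
    · rcases floorFn_cases c with h | h | h | h | h | h <;> linarith
    · linarith [ceilFn_pos c]
  · linarith
  · linarith
  · linarith
  · intro c h1 h2
    constructor
    · rcases floorFn_cases c with h | h | h | h | h | h <;> linarith
    · rcases ceilFn_cases c with h | h | h | h | h | h | h <;> linarith
  · intro c h1 h2
    constructor
    · rcases floorFn_cases c with h | h | h | h | h | h <;> linarith
    · rcases ceilFn_cases c with h | h | h | h | h | h | h <;> linarith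

lemma mem_Vk_of_left_side {y : Pt} (h : y 1 = 124 + 80 * y 0) (hl : -2 ≤ y 0)
    (hr : y 0 ≤ 16 / 150) : y ∈ Vk polygon source 2 := by
  have s0 : source 0 = -33 := by norm_num [source]
  have s1 : source 1 = 0 := by norm_num [source]
  refine mem_Vk_two_of_visible (q := toPt (-9, 20)) (p := !₂[-12 / 5, -68])
    (onEdgeInterior_of_mem ⟨11, ?_⟩) (onEdgeInterior_of_mem ⟨3, ?_⟩)
    (visible_of_line (5 / 6) (55 / 2) ?_ ?_ ?_ ?_ ?_ ?_ ?_)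
    (visible_of_line (-40 / 3) (-100) ?_ ?_ ?_ ?_ ?_ ?_ ?_)
    (visible_of_line 80 124 ?_ ?_ ?_ ?_ ?_ ?_ ?_)
  · rw [openSegment_symm]
    exact (mem_openSegment_toPt_iff (a := (-12, 50)) (b := (-8, 10)) (by norm_num)).2
      (by norm_num)
  · exact (mem_openSegment_toPt_iff (a := (-6, -320)) (b := (-2, -40)) (by norm_num)).2
      (by norm_num)
  all_goals norm_num [s0, s1]
  · intro c h1 h2
    constructor
    · linarith [floorFn_neg c]
    · rcases ceilFn_cases c with h | h | h | h | h | h | h <;> linarith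
  · intro c h1 h2
    constructor
    · linarith [floorFn_neg c]
    · rcases ceilFn_cases c with h | h | h | h | h | h | h <;> linarith
  · intro c h1 h2
    constructor
    · rcases floorFn_cases c with h | h | h | h | h | h <;> linarith
    · rcases ceilFn_cases c with h | h | h | h | h | h | h <;> linarith
  · intro c h1 h2
    constructor
    · rcases floorFn_cases c with h | h | h | h | h | h <;> linarith
    · rcases ceilFn_cases c with h | h | h | h | h | h | h <;> linarith
  · linarith
  · linarith
  · linarith
  · intro c h1 h2
    constructor
    · rcases floorFn_cases c with h | h | h | h | h | h <;> linarith
    · rcases ceilFn_cases c with h | h | h | h | h | h | h <;> linarith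
  · intro c h1 h2
    constructor
    · rcases floorFn_cases c with h | h | h | h | h | h <;> linarith
    · rcases ceilFn_cases c with h | h | h | h | h | h | h <;> linarith

/-- An open triangle around the blind point whose boundary is lit. -/
def litTriangle : Set Pt :=
  {p | 0 < p 1 ∧ p 1 < 140 - 70 * p 0 ∧ p 1 < 124 + 80 * p 0}

lemma isOpen_litTriangle : IsOpen litTriangle := by
  have h1 : IsOpen {p : Pt | 0 < p 1} := isOpen_lt (by fun_prop) (by fun_prop)
  have h2 : IsOpen {p : Pt | p 1 < 140 - 70 * p 0} := isOpen_lt (by fun_prop) (by fun_prop)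
  have h3 : IsOpen {p : Pt | p 1 < 124 + 80 * p 0} := isOpen_lt (by fun_prop) (by fun_prop)
  exact h1.inter (h2.inter h3)

lemma litTriangle_subset_interior : litTriangle ⊆ interior polygonRegion := by
  rintro p ⟨h1, h2, h3⟩
  rw [polygonRegion, interior_regionBetweenGraphs continuous_floorFn continuous_ceilFn]
  refine ⟨by linarith, by linarith, (floorFn_neg _).trans h1, ?_⟩
  rcases ceilFn_cases (p 0) with h | h | h | h | h | h | h <;> linarith

lemma frontier_litTriangle_subset : frontier litTriangle ⊆ Vk polygon source 2 := by
  intro p hp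
  rw [isOpen_litTriangle.frontier_eq] at hp
  have hcl : IsClosed {p : Pt | 0 ≤ p 1 ∧ p 1 ≤ 140 - 70 * p 0 ∧ p 1 ≤ 124 + 80 * p 0} := by
    have h1 : IsClosed {p : Pt | 0 ≤ p 1} := isClosed_le (by fun_prop) (by fun_prop)
    have h2 : IsClosed {p : Pt | p 1 ≤ 140 - 70 * p 0} :=
      isClosed_le (by fun_prop) (by fun_prop)
    have h3 : IsClosed {p : Pt | p 1 ≤ 124 + 80 * p 0} :=
      isClosed_le (by fun_prop) (by fun_prop)
    exact h1.inter (h2.inter h3)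
  have hsub : litTriangle ⊆
      {p : Pt | 0 ≤ p 1 ∧ p 1 ≤ 140 - 70 * p 0 ∧ p 1 ≤ 124 + 80 * p 0} :=
    fun q hq => ⟨hq.1.le, hq.2.1.le, hq.2.2.le⟩
  obtain ⟨h1, h2, h3⟩ := closure_minimal hsub hcl hp.1
  by_cases e1 : p 1 = 0
  · exact mem_Vk_of_eq_zero e1 (by linarith) (by linarith)
  by_cases e2 : p 1 = 140 - 70 * p 0
  · exact mem_Vk_of_right_side e2 (by linarith) (by linarith)
  by_cases e3 : p 1 = 124 + 80 * p 0
  · exact mem_Vk_of_left_side e3 (by linarith) (by linarith)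
  exact absurd ⟨lt_of_le_of_ne h1 (Ne.symm e1), lt_of_le_of_ne h2 e2, lt_of_le_of_ne h3 e3⟩ hp.2

lemma connectedComponentIn_subset_litTriangle :
    connectedComponentIn (Vk polygon source 2)ᶜ blindPoint ⊆ litTriangle := by
  have hx : blindPoint ∈ (Vk polygon source 2)ᶜ := blindPoint_notMem_Vk
  have hxt : blindPoint ∈ litTriangle := by
    have x0 : blindPoint 0 = 0 := by norm_num [blindPoint]
    have x1 : blindPoint 1 = 100 := by norm_num [blindPoint]
    refine ⟨?_, ?_, ?_⟩ <;> rw [x1] <;> norm_num [x0]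
  refine isPreconnected_connectedComponentIn.subset_of_closure_inter_subset isOpen_litTriangle
    ⟨blindPoint, mem_connectedComponentIn hx, hxt⟩ fun z hz => ?_
  by_contra hzt
  refine connectedComponentIn_subset _ _ hz.2 (frontier_litTriangle_subset ?_)
  rw [isOpen_litTriangle.frontier_eq]
  exact ⟨hz.1, hzt⟩

/-- There exist a simple polygon `P` and `s ∈ int P` such that `V₂(s)` is
multiply connected: the complement of `V₂(s)` in the plane has a bounded
connected component entirely contained in the interior of `P`. -/
theorem V2_multiply_connected :
    ∃ (Q : SimplePolygon) (s : Pt),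
      s ∈ interior Q.carrier ∧
      ∃ x : Pt, x ∈ (Vk Q s 2)ᶜ ∧
        Bornology.IsBounded (connectedComponentIn (Vk Q s 2)ᶜ x) ∧
        connectedComponentIn (Vk Q s 2)ᶜ x ⊆ interior Q.carrier := by
  refine ⟨polygon, source, ?_, blindPoint, blindPoint_notMem_Vk,
    polygon.isCompact.isBounded.subset ?_, ?_⟩
  · change source ∈ interior polygonRegion
    rw [polygonRegion, interior_regionBetweenGraphs continuous_floorFn continuous_ceilFn]
    have s1 : source 1 = 0 := by norm_num [source]
    refine ⟨by norm_num [source], by norm_num [source], ?_, ?_⟩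
    · rw [s1]; exact floorFn_neg _
    · rw [s1]; exact ceilFn_pos _
  · exact connectedComponentIn_subset_litTriangle.trans
      (litTriangle_subset_interior.trans interior_subset)
  · exact connectedComponentIn_subset_litTriangle.trans litTriangle_subset_interior
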